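/- Let q ≥ 4, 0 ≤ i ≤ j ≤ n with i+j > n, and let f: Σ_q^n → ℝ be a nonzero function in U_{[i,j]}(n,q). Then the support of f has cardinality at least 2^i (q-1)^{n-j}. -/

import Mathlib

/-- Sum of `f` over the neighbors of `x` in the Hamming graph `H(n,q)`. -/
noncomputable def adjSum (n q : ℕ) (f : (Fin n → Fin q) → ℝ) (x : Fin n → Fin q) : ℝ :=
  ∑ y : Fin n → Fin q, if hammingDist x y = 1 then f y else 0

/-- `f` satisfies the eigenfunction equation for eigenvalue `lam` on `H(n,q)`. -/
def IsEigenfun (n q : ℕ) (lam : ℝ) (f : (Fin n → Fin q) → ℝ) : Prop :=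
  ∀ x, adjSum n q f x = lam * f x

/-- `f ∈ U_i(n,q)`, the eigenspace for eigenvalue `n(q-1) - q i`. -/
def memU (n q i : ℕ) (f : (Fin n → Fin q) → ℝ) : Prop :=
  IsEigenfun n q ((n : ℝ) * ((q : ℝ) - 1) - (q : ℝ) * (i : ℝ)) f

/-- `f ∈ U_{[i,j]}(n,q) = U_i ⊕ ⋯ ⊕ U_j`. -/
def memUI (n q i j : ℕ) (f : (Fin n → Fin q) → ℝ) : Prop :=
  ∃ g : ℕ → (Fin n → Fin q) → ℝ,
    (∀ t ∈ Finset.Icc i j, memU n q t (g t)) ∧ f = ∑ t ∈ Finset.Icc i j, g t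

/-- The cardinality of the support of `f : Σ_q^n → ℝ`. -/
noncomputable def suppCard (n q : ℕ) (f : (Fin n → Fin q) → ℝ) : ℕ :=
  Nat.card {x : Fin n → Fin q // f x ≠ 0}

open Finset

namespace HamSupp

/-- Support size. -/
noncomputable def sp {n q : ℕ} (f : (Fin n → Fin q) → ℝ) : ℕ :=
  ∑ x, if f x ≠ 0 then 1 else 0

/-- Slice of `f` along coordinate `r`. -/
def sl {n q : ℕ} (r : Fin (n + 1)) (k : Fin q) (f : (Fin (n + 1) → Fin q) → ℝ) :
    (Fin n → Fin q) → ℝ := fun y => f (Fin.insertNth (α := fun _ => Fin q) r k y)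

theorem sum_slice {n q : ℕ} {M : Type*} [AddCommMonoid M] (r : Fin (n + 1))
    (F : (Fin (n + 1) → Fin q) → M) :
    ∑ x, F x = ∑ k : Fin q, ∑ y : Fin n → Fin q, F (Fin.insertNth (α := fun _ => Fin q) r k y) := by
  rw [← (Fin.insertNthEquiv (fun _ => Fin q) r).sum_comp, Fintype.sum_prod_type]
  rfl

theorem sp_slice {n q : ℕ} (r : Fin (n + 1)) (f : (Fin (n + 1) → Fin q) → ℝ) :
    sp f = ∑ k, sp (sl r k f) := sum_slice r _

theorem sp_pos {n q : ℕ} {f : (Fin n → Fin q) → ℝ} (hf : f ≠ 0) : 1 ≤ sp f := by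
  obtain ⟨x, hx⟩ := Function.ne_iff.mp hf
  have h := Finset.single_le_sum (f := fun x => if f x ≠ 0 then 1 else 0)
    (fun i _ => Nat.zero_le _) (Finset.mem_univ x)
  have hx' : f x ≠ 0 := hx
  simp only [hx', ne_eq, not_false_eq_true, if_true] at h
  exact h

theorem sp_comb {n q : ℕ} (f g h : (Fin n → Fin q) → ℝ)
    (H : ∀ x, f x = 0 → g x = 0 → h x = 0) : sp h ≤ sp f + sp g := by
  unfold sp
  rw [← Finset.sum_add_distrib]
  apply Finset.sum_le_sum
  intro x _
  have := H x
  split_ifs <;> first | omega | tauto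

theorem sp_sub {n q : ℕ} (f g : (Fin n → Fin q) → ℝ) : sp (f - g) ≤ sp f + sp g :=
  sp_comb _ _ _ (fun x h1 h2 => by simp [h1, h2])

theorem sp_mono {n q : ℕ} (f h : (Fin n → Fin q) → ℝ)
    (H : ∀ x, f x = 0 → h x = 0) : sp h ≤ sp f := by
  unfold sp
  apply Finset.sum_le_sum
  intro x _
  have := H x
  split_ifs <;> first | omega | tauto

theorem ham_ins {n q : ℕ} (r : Fin (n + 1)) (k m : Fin q) (y z : Fin n → Fin q) :
    hammingDist (Fin.insertNth (α := fun _ => Fin q) r k y)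
      (Fin.insertNth (α := fun _ => Fin q) r m z) = (if k ≠ m then 1 else 0) + hammingDist y z := by
  unfold hammingDist
  rw [Finset.card_filter, Finset.card_filter, Fin.sum_univ_succAbove _ r]
  simp

/-- Adjacency operator. -/
noncomputable def adj (n q : ℕ) : Module.End ℝ ((Fin n → Fin q) → ℝ) where
  toFun f := fun x => adjSum n q f x
  map_add' f g := by
    ext x
    simp only [adjSum, Pi.add_apply, ← Finset.sum_add_distrib]
    exact Finset.sum_congr rfl (fun y _ => by split_ifs <;> simp)
  map_smul' c f := by
    ext x
    simp only [adjSum, Pi.smul_apply, smul_eq_mul, Finset.mul_sum, RingHom.id_apply]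
    exact Finset.sum_congr rfl (fun y _ => by split_ifs <;> simp)

theorem adj_slice {n q : ℕ} (r : Fin (n + 1)) (k : Fin q) (f : (Fin (n + 1) → Fin q) → ℝ) :
    sl r k (adj (n + 1) q f) = adj n q (sl r k f) + ((∑ m, sl r m f) - sl r k f) := by
  ext y
  have h1 : sl r k (adj (n + 1) q f) y =
      ∑ m : Fin q, ∑ z : Fin n → Fin q,
        if (if k ≠ m then 1 else 0) + hammingDist y z = 1 then sl r m f z else 0 := by
    change adjSum (n + 1) q f _ = _
    unfold adjSum
    rw [sum_slice r]
    simp only [ham_ins]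
    rfl
  have h2 : adj n q (sl r k f) y = ∑ z : Fin n → Fin q,
      if hammingDist y z = 1 then sl r k f z else 0 := rfl
  rw [h1, ← Finset.add_sum_erase _ _ (Finset.mem_univ k)]
  simp only [Pi.add_apply, Pi.sub_apply, Finset.sum_apply]
  rw [h2, ← Finset.add_sum_erase _ (fun m => sl r m f y) (Finset.mem_univ k)]
  congr 1
  · simp
  · rw [add_sub_cancel_left]
    apply Finset.sum_congr rfl
    intro m hm
    have hm' : k ≠ m := (Finset.ne_of_mem_erase hm).symm
    simp [hm', hammingDist_eq_zero]

/-- Eigenvalue. -/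
noncomputable def ev (n q : ℕ) (t : ℤ) : ℝ := (n : ℝ) * ((q : ℝ) - 1) - (q : ℝ) * (t : ℝ)

/-- Eigenspace. -/
noncomputable def U (n q : ℕ) (t : ℤ) : Submodule ℝ ((Fin n → Fin q) → ℝ) :=
  (adj n q).eigenspace (ev n q t)

theorem mem_U {n q : ℕ} {t : ℤ} {f : (Fin n → Fin q) → ℝ} :
    f ∈ U n q t ↔ adj n q f = ev n q t • f := Module.End.mem_eigenspace_iff

/-- Span of eigenspaces. -/
noncomputable def W (n q : ℕ) (a b : ℤ) : Submodule ℝ ((Fin n → Fin q) → ℝ) :=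
  ⨆ t ∈ Set.Icc a b, U n q t

theorem sl_smul {n q : ℕ} (r : Fin (n + 1)) (k : Fin q) (c : ℝ) (f : (Fin (n + 1) → Fin q) → ℝ) :
    sl r k (c • f) = c • sl r k f := rfl

theorem sl_add {n q : ℕ} (r : Fin (n + 1)) (k : Fin q) (f g : (Fin (n + 1) → Fin q) → ℝ) :
    sl r k (f + g) = sl r k f + sl r k g := rfl

/-- Slice as a linear map. -/
def slL {n q : ℕ} (r : Fin (n + 1)) (k : Fin q) :
    ((Fin (n + 1) → Fin q) → ℝ) →ₗ[ℝ] ((Fin n → Fin q) → ℝ) where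
  toFun := sl r k
  map_add' := sl_add r k
  map_smul' := sl_smul r k

theorem U_slice {n q : ℕ} {t : ℤ} {f : (Fin (n + 1) → Fin q) → ℝ} (hf : f ∈ U (n + 1) q t)
    (r : Fin (n + 1)) (k : Fin q) :
    adj n q (sl r k f) = (ev n q t + q) • sl r k f - ∑ m, sl r m f := by
  have h := adj_slice r k f
  rw [mem_U.mp hf, sl_smul] at h
  have e : ev (n + 1) q t = ev n q t + q - 1 := by unfold ev; push_cast; ring
  rw [e] at h
  have h' := congrArg (fun z => z - ((∑ m, sl r m f) - sl r k f)) h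
  simp only [add_sub_cancel_right] at h'
  rw [← h']
  module

theorem U_sum {n q : ℕ} {t : ℤ} {f : (Fin (n + 1) → Fin q) → ℝ} (hf : f ∈ U (n + 1) q t)
    (r : Fin (n + 1)) : ∑ m, sl r m f ∈ U n q t := by
  rw [mem_U, map_sum, Finset.sum_congr rfl (fun k _ => U_slice hf r k)]
  rw [Finset.sum_sub_distrib, ← Finset.smul_sum]
  simp only [Finset.sum_const, Finset.card_univ, Fintype.card_fin, ← Nat.cast_smul_eq_nsmul ℝ]
  module

theorem U_diff {n q : ℕ} {t : ℤ} {f : (Fin (n + 1) → Fin q) → ℝ} (hf : f ∈ U (n + 1) q t)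
    (r : Fin (n + 1)) (k m : Fin q) : sl r k f - sl r m f ∈ U n q (t - 1) := by
  rw [mem_U, map_sub, U_slice hf, U_slice hf]
  have e : ev n q (t - 1) = ev n q t + q := by unfold ev; push_cast; ring
  rw [e]
  module

theorem slice_eq {n q : ℕ} (hq : q ≠ 0) (r : Fin (n + 1)) (k : Fin q)
    (f : (Fin (n + 1) → Fin q) → ℝ) :
    sl r k f = (q : ℝ)⁻¹ • ((∑ m, sl r m f) + ∑ m, (sl r k f - sl r m f)) := by
  rw [← Finset.sum_add_distrib]
  simp only [add_sub_cancel, Finset.sum_const, Finset.card_univ, Fintype.card_fin,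
    ← Nat.cast_smul_eq_nsmul ℝ]
  rw [smul_smul, inv_mul_cancel₀ (by exact_mod_cast hq), one_smul]

theorem ext_slice {n q : ℕ} (r : Fin (n + 1)) {f : (Fin (n + 1) → Fin q) → ℝ}
    (h : ∀ k, sl r k f = 0) : f = 0 := by
  ext x
  have := congrFun (h (x r)) (fun i => x (r.succAbove i))
  have e : Fin.insertNth (α := fun _ => Fin q) r (x r) (fun i => x (r.succAbove i)) = x :=
    Fin.insertNth_self_removeNth r x
  unfold sl at this
  rw [e] at this
  exact this

theorem U_bot {q : ℕ} (hq : q ≠ 0) (n : ℕ) : ∀ t : ℤ, (t < 0 ∨ (n : ℤ) < t) → U n q t = ⊥ := by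
  induction n with
  | zero =>
    intro t ht
    rw [eq_bot_iff]
    intro f hf
    rw [mem_U] at hf
    have h0 : adj 0 q f = 0 := by
      ext x
      change adjSum 0 q f x = 0
      unfold adjSum
      apply Finset.sum_eq_zero
      intro y _
      have : x = y := Subsingleton.elim _ _
      simp [this]
    rw [h0] at hf
    have : ev 0 q t ≠ 0 := by
      unfold ev
      have : (t : ℝ) ≠ 0 := by
        have : t ≠ 0 := by omega
        exact_mod_cast this
      have hq' : (q : ℝ) ≠ 0 := by exact_mod_cast hq
      simp [this, hq']
    rcases smul_eq_zero.mp hf.symm with h | h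
    · exact absurd h this
    · exact h
  | succ n ih =>
    intro t ht
    rw [eq_bot_iff]
    intro f hf
    change f = 0
    apply ext_slice 0
    intro k
    rw [slice_eq hq]
    have h1 := U_sum hf 0
    rw [ih t (by omega)] at h1
    have h2 : ∀ m, sl 0 k f - sl 0 m f = 0 := by
      intro m
      have := U_diff hf 0 k m
      rw [ih (t - 1) (by omega)] at this
      exact this
    have h1' : ∑ m, sl 0 m f = 0 := h1
    rw [h1', Finset.sum_congr rfl (fun m _ => h2 m)]
    simp

theorem U_le_W {n q : ℕ} {a b t : ℤ} (h1 : a ≤ t) (h2 : t ≤ b) : U n q t ≤ W n q a b :=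
  le_iSup₂_of_le (f := fun t (_ : t ∈ Set.Icc a b) => U n q t) t ⟨h1, h2⟩ le_rfl

theorem W_le {n q : ℕ} (hq : q ≠ 0) {a b a' b' : ℤ} (ha : a' ≤ a ∨ a' ≤ 0)
    (hb : b ≤ b' ∨ (n : ℤ) ≤ b') : W n q a b ≤ W n q a' b' := by
  apply iSup₂_le
  rintro t ⟨h1, h2⟩
  by_cases h : t < 0 ∨ (n : ℤ) < t
  · rw [U_bot hq n t h]; exact bot_le
  · exact U_le_W (by omega) (by omega)

theorem W_zero {n q : ℕ} (hq : q ≠ 0) {a b : ℤ} (h : b < a ∨ b < 0 ∨ (n : ℤ) < a)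
    {f : (Fin n → Fin q) → ℝ} (hf : f ∈ W n q a b) : f = 0 := by
  have : W n q a b ≤ ⊥ := by
    apply iSup₂_le
    rintro t ⟨h1, h2⟩
    rw [U_bot hq n t (by omega)]
  exact this hf

theorem W_sum {n q : ℕ} {a b : ℤ} {f : (Fin (n + 1) → Fin q) → ℝ} (hf : f ∈ W (n + 1) q a b)
    (r : Fin (n + 1)) : ∑ m, sl r m f ∈ W n q a b := by
  have : W (n + 1) q a b ≤ (W n q a b).comap (∑ m, slL r m) := by
    apply iSup₂_le
    rintro t ⟨h1, h2⟩ g hg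
    have := U_le_W h1 h2 (U_sum hg r)
    simpa [slL] using this
  simpa [slL] using this hf

theorem W_diff {n q : ℕ} {a b : ℤ} {f : (Fin (n + 1) → Fin q) → ℝ} (hf : f ∈ W (n + 1) q a b)
    (r : Fin (n + 1)) (k m : Fin q) : sl r k f - sl r m f ∈ W n q (a - 1) (b - 1) := by
  have : W (n + 1) q a b ≤ (W n q (a - 1) (b - 1)).comap (slL r k - slL r m) := by
    apply iSup₂_le
    rintro t ⟨h1, h2⟩ g hg
    exact U_le_W (by omega) (by omega) (U_diff hg r k m)
  exact this hf

theorem W_slice {n q : ℕ} (hq : q ≠ 0) {a b : ℤ} {f : (Fin (n + 1) → Fin q) → ℝ}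
    (hf : f ∈ W (n + 1) q a b) (r : Fin (n + 1)) (k : Fin q) : sl r k f ∈ W n q (a - 1) b := by
  rw [slice_eq hq]
  apply Submodule.smul_mem
  apply Submodule.add_mem
  · exact W_le hq (by omega) (by omega) (W_sum hf r)
  · exact Submodule.sum_mem _ (fun m _ => W_le hq (by omega) (by omega) (W_diff hf r k m))

theorem ev_inj {n q : ℕ} (hq : q ≠ 0) : Function.Injective (ev n q) := by
  intro s t h
  unfold ev at h
  have hq' : (q : ℝ) ≠ 0 := by exact_mod_cast hq
  have : (q : ℝ) * s = q * t := by linarith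
  exact_mod_cast mul_left_cancel₀ hq' this

theorem W_inter {n q : ℕ} (hq : q ≠ 0) {a b : ℤ} {f : (Fin n → Fin q) → ℝ}
    (h1 : f ∈ W n q a b) (h2 : f ∈ W n q (a - 1) (b - 1)) : f ∈ W n q a (b - 1) := by
  by_cases hab : b < a
  · rw [W_zero hq (Or.inl hab) h1]; exact Submodule.zero_mem _
  have hle : W n q a b ≤ W n q a (b - 1) ⊔ U n q b := by
    apply iSup₂_le
    rintro t ⟨h1, h2⟩
    by_cases h : t = b
    · subst h; exact le_sup_right
    · exact le_sup_of_le_left (U_le_W (by omega) (by omega))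
  obtain ⟨x, hx, y, hy, rfl⟩ := Submodule.mem_sup.mp (hle h1)
  have hind : iSupIndep (U n q) := (Module.End.eigenspaces_iSupIndep (adj n q)).comp (ev_inj hq)
  have hd : Disjoint (U n q b) (⨆ t ∈ Set.Icc (a - 1) (b - 1), U n q t) :=
    hind.disjoint_biSup (by simp)
  have hy' : y ∈ W n q (a - 1) (b - 1) := by
    have := Submodule.sub_mem _ h2 (W_le hq (a' := a - 1) (b' := b - 1) (by omega) (by omega) hx)
    simpa using this
  have : y = 0 := Submodule.disjoint_def.mp hd y hy hy'
  rw [this, add_zero]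
  exact hx

theorem trich {q : ℕ} (hq : 4 ≤ q) {X : Type*} (F : Fin q → X) :
    (∃ a b c d, a ≠ c ∧ a ≠ d ∧ b ≠ c ∧ b ≠ d ∧ F a ≠ F b ∧ F c ≠ F d) ∨
    ∃ c, ∀ k m, k ≠ c → m ≠ c → F k = F m := by
  by_contra! hcon
  obtain ⟨h1, h2⟩ := hcon
  obtain ⟨a, b, -, -, hab⟩ := h2 ⟨0, by omega⟩
  -- all other values coincide
  have h3 : ∀ c d, a ≠ c → a ≠ d → b ≠ c → b ≠ d → F c = F d :=
    fun c d x1 x2 x3 x4 => h1 a b c d x1 x2 x3 x4 hab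
  have hex : ∃ c d : Fin q, a ≠ c ∧ a ≠ d ∧ b ≠ c ∧ b ≠ d ∧ c ≠ d := by
    have hc : 1 < (Finset.univ \ {a, b} : Finset (Fin q)).card := by
      have h4 := Finset.le_card_sdiff {a, b} (Finset.univ : Finset (Fin q))
      have h5 : ({a, b} : Finset (Fin q)).card ≤ 2 := Finset.card_le_two
      simp only [Finset.card_univ, Fintype.card_fin] at h4
      omega
    obtain ⟨c, hc, d, hd, hcd⟩ := Finset.one_lt_card.mp hc
    simp only [Finset.mem_sdiff, Finset.mem_univ, true_and, Finset.mem_insert,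
      Finset.mem_singleton, not_or] at hc hd
    exact ⟨c, d, fun h => hc.1 h.symm, fun h => hd.1 h.symm, fun h => hc.2 h.symm,
      fun h => hd.2 h.symm, hcd⟩
  obtain ⟨c, d, e1, e2, e3, e4, e5⟩ := hex
  have hne : a ≠ b := fun h => hab (by rw [h])
  have hcd := h3 c d e1 e2 e3 e4
  have key : ∀ u v : Fin q, F u ≠ F v → (∀ x, u ≠ x → v ≠ x → F x = F c) →
      u ≠ c → v ≠ c → u ≠ d → v ≠ d → F v = F c → False := by
    intro u v huv hx uc vc ud vd hvc
    obtain ⟨k, m, hk, hm, hkm⟩ := h2 u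
    apply hkm
    have : ∀ x, x ≠ u → F x = F c := by
      intro x hxu
      by_cases hxv : x = v
      · rw [hxv, hvc]
      · exact hx x hxu.symm (fun h => hxv h.symm)
    rw [this k hk, this m hm]
  have hall : ∀ x, a ≠ x → b ≠ x → F x = F c := fun x h h' => h3 x c h e1 h' e3
  by_cases hbc : F b = F c
  · exact key a b hab hall e1 e3 e2 e4 hbc
  by_cases hac : F a = F c
  · exact key b a hab.symm (fun x h h' => hall x h' h) e3 e1 e4 e2 hac
  -- pairs (a,c), (b,d)
  exact hbc ((h1 a c b d hne e2 e3.symm e5 hac).trans hcd.symm)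

/-- Two-valued functions in every coordinate. -/
def Spec {n q : ℕ} (c : Fin n → Fin q) (f : (Fin n → Fin q) → ℝ) : Prop :=
  ∀ r x a b, a ≠ c r → b ≠ c r → f (Function.update x r a) = f (Function.update x r b)

theorem spec_slice {n q : ℕ} {c : Fin (n + 1) → Fin q} {f : (Fin (n + 1) → Fin q) → ℝ}
    (h : Spec c f) (k : Fin q) : Spec (fun i => c i.succ) (sl 0 k f) := by
  intro r x a b ha hb
  have := h r.succ (Fin.cons k x) a b ha hb
  simp only [sl, Fin.insertNth_zero']
  rw [Fin.cons_update, Fin.cons_update]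
  exact this

theorem spec_eq {n q : ℕ} {c : Fin (n + 1) → Fin q} {f : (Fin (n + 1) → Fin q) → ℝ}
    (h : Spec c f) (k m : Fin q) (hk : k ≠ c 0) (hm : m ≠ c 0) : sl 0 k f = sl 0 m f := by
  ext y
  have := h 0 (Fin.cons k y) k m hk hm
  simpa [sl, Fin.insertNth_zero'] using this

theorem spec_of {n q : ℕ} {c : Fin (n + 1) → Fin q} {f : (Fin (n + 1) → Fin q) → ℝ}
    (h : ∀ r k m, k ≠ c r → m ≠ c r → sl r k f = sl r m f) : Spec c f := by
  intro r x a b ha hb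
  have := congrFun (h r a b ha hb) (r.removeNth x)
  simp only [sl, Fin.insertNth_removeNth] at this
  exact this

theorem two_pairs {n q : ℕ} (r : Fin (n + 1)) (f : (Fin (n + 1) → Fin q) → ℝ) (B : ℕ)
    (hB : ∀ k m, sl r k f ≠ sl r m f → B ≤ sp (sl r k f) + sp (sl r m f))
    (h : ∃ a b c d, a ≠ c ∧ a ≠ d ∧ b ≠ c ∧ b ≠ d ∧ sl r a f ≠ sl r b f ∧ sl r c f ≠ sl r d f) :
    2 * B ≤ sp f := by
  obtain ⟨a, b, c, d, h1, h2, h3, h4, h5, h6⟩ := h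
  have hab : a ≠ b := fun h => h5 (by rw [h])
  have hcd : c ≠ d := fun h => h6 (by rw [h])
  have : ∑ k ∈ ({a, b, c, d} : Finset (Fin q)), sp (sl r k f) ≤ sp f := by
    rw [sp_slice r]
    exact Finset.sum_le_sum_of_subset (Finset.subset_univ _)
  rw [Finset.sum_insert (by simp [*]), Finset.sum_insert (by simp [*]),
    Finset.sum_insert (by simp [*]), Finset.sum_singleton] at this
  have := hB a b h5
  have := hB c d h6
  omega

theorem one_pair {n q : ℕ} (r : Fin (n + 1)) (f : (Fin (n + 1) → Fin q) → ℝ)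
    (k m : Fin q) (h : k ≠ m) : sp (sl r k f) + sp (sl r m f) ≤ sp f := by
  have : ∑ k ∈ ({k, m} : Finset (Fin q)), sp (sl r k f) ≤ sp f := by
    rw [sp_slice r]
    exact Finset.sum_le_sum_of_subset (Finset.subset_univ _)
  rwa [Finset.sum_pair h] at this

theorem exists_ne_q {q : ℕ} (hq : 4 ≤ q) (c : Fin q) : ∃ d, d ≠ c := by
  have : Nontrivial (Fin q) := Fin.nontrivial_iff_two_le.mpr (by omega)
  exact exists_ne c

/-- Structure when all slices but one coincide. -/
theorem one_diff {n p : ℕ} (r : Fin (n + 1)) (f : (Fin (n + 1) → Fin (p + 1)) → ℝ)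
    (c d : Fin (p + 1)) (hd : d ≠ c) (h : ∀ k m, k ≠ c → m ≠ c → sl r k f = sl r m f) :
    sp f = p * sp (sl r d f) + sp (sl r c f) ∧
    ∑ m, sl r m f = (p : ℝ) • sl r d f + sl r c f := by
  constructor
  · rw [sp_slice r, ← Finset.sum_erase_add _ _ (Finset.mem_univ c),
      Finset.sum_congr rfl (g := fun _ => sp (sl r d f))
        (fun k hk => by rw [h k d (Finset.ne_of_mem_erase hk) hd])]
    simp
  · rw [← Finset.sum_erase_add _ _ (Finset.mem_univ c),
      Finset.sum_congr rfl (g := fun _ => sl r d f)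
        (fun k hk => by rw [h k d (Finset.ne_of_mem_erase hk) hd])]
    simp [← Nat.cast_smul_eq_nsmul ℝ]

/-- Bound for `i + j ≤ n`. -/
def PA (p n : ℕ) : Prop := ∀ i j d : ℕ, i + j + d = n → ∀ f : (Fin n → Fin (p + 1)) → ℝ,
  f ∈ W n (p + 1) i j → f ≠ 0 → (2 * p) ^ i * (p + 1) ^ d ≤ sp f

/-- Bound for `i + j ≥ n`. -/
def PB (p n : ℕ) : Prop := ∀ j k e : ℕ, j + k = n → ∀ f : (Fin n → Fin (p + 1)) → ℝ,
  f ∈ W n (p + 1) (k + e : ℕ) j → f ≠ 0 → 2 ^ e * (2 * p) ^ k ≤ sp f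

/-- Bound for `i + j ≥ n`, special functions. -/
def PC (p n : ℕ) : Prop := ∀ j k e : ℕ, j + k = n → ∀ f : (Fin n → Fin (p + 1)) → ℝ,
  f ∈ W n (p + 1) (k + e : ℕ) j → f ≠ 0 → (∃ c, Spec c f) → (p + 1) ^ e * (2 * p) ^ k ≤ sp f

theorem stepA {p n : ℕ} (hp : 3 ≤ p) (hA : PA p n) (hB : PB p n) : PA p (n + 1) := by
  intro i j d hn f hf hf0
  have hq0 : p + 1 ≠ 0 := by omega
  rcases trich (by omega) (fun k => sl 0 k f) with h | ⟨c, hc⟩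
  · -- two disjoint pairs
    have hjj : ∃ j', j = j' + 1 := by
      rcases j with _ | j'
      · exfalso
        obtain ⟨a, b, -, -, -, -, -, -, h5, -⟩ := h
        exact h5 (sub_eq_zero.mp (W_zero hq0 (by omega) (W_diff hf 0 a b)))
      · exact ⟨j', rfl⟩
    obtain ⟨j', rfl⟩ := hjj
    rcases i with _ | i'
    · have := two_pairs 0 f ((p + 1) ^ d) (by
        intro k m hkm
        refine le_trans ?_ (sp_sub _ _)
        have := hA 0 j' d (by omega) _ (W_le hq0 (by omega) (by omega)
          (W_diff hf 0 k m)) (sub_ne_zero.mpr hkm)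
        simpa using this) h
      simp only [pow_zero, one_mul]
      omega
    · have := two_pairs 0 f ((2 * p) ^ i' * (p + 1) ^ (d + 1)) (by
        intro k m hkm
        refine le_trans ?_ (sp_sub _ _)
        exact hA i' j' (d + 1) (by omega) _ (W_le hq0 (by omega) (by omega)
          (W_diff hf 0 k m)) (sub_ne_zero.mpr hkm)) h
      refine le_trans ?_ this
      rw [pow_succ, pow_succ]
      nlinarith [Nat.zero_le ((2 * p) ^ i' * (p + 1) ^ d)]
  · obtain ⟨d0, hd0⟩ := exists_ne_q (by omega) c
    obtain ⟨hsp, hsum⟩ := one_diff 0 f c d0 hd0 hc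
    have hW := W_sum hf 0
    rw [hsum] at hW
    have hg := W_slice hq0 hf 0 d0
    have hD := W_diff hf 0 d0 c
    have hpair := one_pair 0 f d0 c hd0
    have hzero : sl 0 d0 f = 0 → sl 0 c f = 0 → False := by
      intro h1 h2
      apply hf0
      apply ext_slice 0
      intro k
      by_cases hk : k = c
      · rw [hk, h2]
      · rw [hc k d0 hk hd0, h1]
    generalize sl 0 d0 f = g at *
    generalize sl 0 c f = h at *
    by_cases hgh : g = h
    · subst hgh
      have hg0 : g ≠ 0 := fun h => hzero h h
      have hgW : g ∈ W n (p + 1) i j := by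
        have e : (p : ℝ) • g + g = ((p : ℝ) + 1) • g := by module
        rw [e] at hW
        exact (Submodule.smul_mem_iff _ (by positivity)).mp hW
      rcases d with _ | d'
      · rcases i with _ | i'
        · simpa using sp_pos hf0
        · have := hB j i' 1 (by omega) g hgW hg0
          rw [hsp]
          rw [pow_succ]
          nlinarith
      · have := hA i j d' (by omega) g hgW hg0
        rw [hsp, pow_succ]
        nlinarith
    · have hjj : ∃ j', j = j' + 1 := by
        rcases j with _ | j'
        · exfalso
          exact hgh (sub_eq_zero.mp (W_zero hq0 (by omega) hD))
        · exact ⟨j', rfl⟩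
      obtain ⟨j', rfl⟩ := hjj
      have hsub := sp_sub g h
      rcases i with _ | i'
      · have := hA 0 j' d (by omega) _ (W_le hq0 (by omega) (by omega)
          hD) (sub_ne_zero.mpr hgh)
        omega
      · by_cases hg0 : g = 0
        · subst hg0
          have hh : h ∈ W n (p + 1) (i' + 1 : ℕ) j' := by
            have e1 : h ∈ W n (p + 1) (i' + 1 : ℕ) (j' + 1 : ℕ) := by simpa using hW
            have e2 : h ∈ W n (p + 1) ((i' + 1 : ℕ) - 1) ((j' + 1 : ℕ) - 1) := by
              have := Submodule.neg_mem _ hD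
              simpa using this
            have := W_inter hq0 e1 e2
            simpa using this
          have := hA (i' + 1) j' d (by omega) h hh (fun e => hzero rfl e)
          omega
        · have h1 := hA i' (j' + 1) d (by omega) g (W_le hq0 (by omega)
            (by omega) hg) hg0
          have h2 := hA i' j' (d + 1) (by omega) _ (W_le hq0 (by omega)
            (by omega) hD) (sub_ne_zero.mpr hgh)
          obtain ⟨s, rfl⟩ : ∃ s, p = s + 1 := ⟨p - 1, by omega⟩
          have h3 := Nat.mul_le_mul_left s h1
          rw [hsp]
          rw [pow_succ] at h2 ⊢
          nlinarith

theorem stepC {p n : ℕ} (hp : 3 ≤ p) (hA : PA p (n + 1)) (hC : PC p n) : PC p (n + 1) := by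
  intro j k e hn f hf hf0 ⟨c, hs⟩
  have hq0 : p + 1 ≠ 0 := by omega
  rcases e with _ | e
  · simpa using hA k j 0 (by omega) f (by simpa using hf) hf0
  obtain ⟨d0, hd0⟩ := exists_ne_q (by omega) (c 0)
  obtain ⟨hsp, hsum⟩ := one_diff 0 f (c 0) d0 hd0 (spec_eq hs)
  have hW := W_sum hf 0
  rw [hsum] at hW
  have hg := W_slice hq0 hf 0 d0
  have hD := W_diff hf 0 d0 (c 0)
  have hsg : ∃ c, Spec c (sl 0 d0 f) := ⟨_, spec_slice hs d0⟩
  have hsh : ∃ c', Spec c' (sl 0 (c 0) f) := ⟨_, spec_slice hs (c 0)⟩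
  have hzero : sl 0 d0 f = 0 → sl 0 (c 0) f = 0 → False := by
    intro h1 h2
    apply hf0
    apply ext_slice 0
    intro k
    by_cases hk : k = c 0
    · rw [hk, h2]
    · rw [spec_eq hs k d0 hk hd0, h1]
  have hlin : ∀ α β : ℝ, ∃ c', Spec c' (α • sl 0 d0 f + β • sl 0 (c 0) f) := by
    intro α β
    refine ⟨fun i => c i.succ, ?_⟩
    intro r x a b ha hb
    simp only [Pi.add_apply, Pi.smul_apply]
    rw [spec_slice hs d0 r x a b ha hb, spec_slice hs (c 0) r x a b ha hb]
  generalize sl 0 d0 f = g at *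
  generalize sl 0 (c 0) f = h at *
  have hp0 : (p : ℝ) ≠ 0 := by
    have : p ≠ 0 := by omega
    exact_mod_cast this
  by_cases hg0 : g = 0
  · subst hg0
    have e1 : h ∈ W n (p + 1) (k + (e + 1) : ℕ) j := by simpa using hW
    have e2 : h ∈ W n (p + 1) ((k + (e + 1) : ℕ) - 1) (j - 1) := by
      have := Submodule.neg_mem _ hD
      simpa using this
    have e3 := W_inter hq0 e1 e2
    have hh0 : h ≠ 0 := fun e => hzero rfl e
    rcases j with _ | j'
    · exact absurd (W_zero hq0 (by omega) e3) hh0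
    · have := hC j' k (e + 1) (by omega) h (by simpa using e3) hh0 hsh
      omega
  by_cases ha : (p : ℝ) • g + h = 0
  · have hh : h = (-(p : ℝ)) • g := by
      rw [neg_smul]; exact eq_neg_of_add_eq_zero_right ha
    have hgW : g ∈ W n (p + 1) ((k + (e + 1) : ℕ) - 1) (j - 1) := by
      rw [hh] at hD
      have e : g - (-(p : ℝ)) • g = ((p : ℝ) + 1) • g := by module
      rw [e] at hD
      exact (Submodule.smul_mem_iff _ (by positivity)).mp hD
    rcases j with _ | j'
    · exact absurd (W_zero hq0 (by omega) hgW) hg0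
    · have h1 := hC j' k e (by omega) g (W_le hq0 (by omega) (by omega) hgW)
        hg0 hsg
      have h2 : sp g ≤ sp h := by
        apply sp_mono
        intro x hx
        rw [hh] at hx
        simpa [hp0] using hx
      rw [hsp, pow_succ]
      nlinarith
  · have hsa : ∃ c, Spec c ((p : ℝ) • g + h) := by simpa using hlin p 1
    have hcomb : sp ((p : ℝ) • g + h) ≤ sp g + sp h :=
      sp_comb _ _ _ (fun x h1 h2 => by simp [h1, h2])
    obtain ⟨s, rfl⟩ : ∃ s, p = s + 1 := ⟨p - 1, by omega⟩
    rcases k with _ | k'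
    · have h1 := hC n 0 (e + 1) (by omega) _ (W_le hq0 (by omega)
        (by omega) hW) ha hsa
      rw [hsp]
      nlinarith
    · have h1 := hC j k' (e + 2) (by omega) _ (W_le hq0 (by omega)
        (by omega) hW) ha hsa
      have h2 := hC j k' (e + 1) (by omega) g (W_le hq0 (by omega)
        (by omega) hg) hg0 hsg
      have h3 := Nat.mul_le_mul_left s h2
      rw [hsp]
      rw [show e + 2 = (e + 1) + 1 from rfl, pow_succ _ (e + 1)] at h1
      rw [pow_succ _ k']
      nlinarith

theorem stepB {p n : ℕ} (hp : 3 ≤ p) (hA : PA p (n + 1)) (hC : PC p (n + 1)) (hB : PB p n) :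
    PB p (n + 1) := by
  intro j k e hn f hf hf0
  have hq0 : p + 1 ≠ 0 := by omega
  rcases e with _ | e
  · simpa using hA k j 0 (by omega) f (by simpa using hf) hf0
  by_cases hex : ∃ r : Fin (n + 1), ∃ a b c d, a ≠ c ∧ a ≠ d ∧ b ≠ c ∧ b ≠ d ∧
      sl r a f ≠ sl r b f ∧ sl r c f ≠ sl r d f
  · obtain ⟨r, h⟩ := hex
    have hjj : ∃ j', j = j' + 1 := by
      rcases j with _ | j'
      · exfalso
        obtain ⟨a, b, -, -, -, -, -, -, h5, -⟩ := h
        exact h5 (sub_eq_zero.mp (W_zero hq0 (by omega) (W_diff hf r a b)))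
      · exact ⟨j', rfl⟩
    obtain ⟨j', rfl⟩ := hjj
    have := two_pairs r f (2 ^ e * (2 * p) ^ k) (by
      intro k' m hkm
      refine le_trans ?_ (sp_sub _ _)
      exact hB j' k e (by omega) _ (W_le hq0 (by omega) (by omega)
        (W_diff hf r k' m)) (sub_ne_zero.mpr hkm)) h
    refine le_trans (le_of_eq ?_) this
    ring
  · have hsp : ∀ r : Fin (n + 1), ∃ c, ∀ k m, k ≠ c → m ≠ c → sl r k f = sl r m f := by
      intro r
      rcases trich (by omega) (fun k => sl r k f) with h | h
      · exact absurd ⟨r, h⟩ hex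
      · exact h
    choose c hc using hsp
    have := hC j k (e + 1) hn f hf hf0 ⟨c, spec_of hc⟩
    refine le_trans (Nat.mul_le_mul_right _ (Nat.pow_le_pow_left (by omega) _)) this

theorem all_bounds {p : ℕ} (hp : 3 ≤ p) (n : ℕ) : PA p n ∧ PB p n ∧ PC p n := by
  induction n with
  | zero =>
    have hq0 : p + 1 ≠ 0 := by omega
    refine ⟨?_, ?_, ?_⟩
    · intro i j d hn f _ hf0
      obtain ⟨rfl, rfl, rfl⟩ : i = 0 ∧ j = 0 ∧ d = 0 := by omega
      simpa using sp_pos hf0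
    · intro j k e hn f hf hf0
      obtain ⟨rfl, rfl⟩ : j = 0 ∧ k = 0 := by omega
      rcases e with _ | e
      · simpa using sp_pos hf0
      · exact absurd (W_zero hq0 (by omega) hf) hf0
    · intro j k e hn f hf hf0 _
      obtain ⟨rfl, rfl⟩ : j = 0 ∧ k = 0 := by omega
      rcases e with _ | e
      · simpa using sp_pos hf0
      · exact absurd (W_zero hq0 (by omega) hf) hf0
  | succ n ih =>
    obtain ⟨hA, hB, hC⟩ := ih
    have hA' := stepA hp hA hB
    have hC' := stepC hp hA' hC
    exact ⟨hA', stepB hp hA' hC' hB, hC'⟩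

theorem suppCard_eq {n q : ℕ} (f : (Fin n → Fin q) → ℝ) : suppCard n q f = sp f := by
  classical
  unfold suppCard sp
  rw [Nat.card_eq_fintype_card, Fintype.card_subtype, Finset.card_filter]

theorem mem_W_of {n q i j : ℕ} {f : (Fin n → Fin q) → ℝ} (h : memUI n q i j f) :
    f ∈ W n q i j := by
  obtain ⟨g, hg, rfl⟩ := h
  apply Submodule.sum_mem
  intro t ht
  have h1 := hg t ht
  rw [Finset.mem_Icc] at ht
  apply U_le_W (t := (t : ℤ)) (by exact_mod_cast ht.1) (by exact_mod_cast ht.2)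
  rw [mem_U]
  ext x
  have := h1 x
  simp only [ev, Pi.smul_apply, smul_eq_mul, Int.cast_natCast]
  exact this

end HamSupp

/-- a nonzero f ∈ U_{[i,j]}(n,q), q ≥ 4, i ≤ j ≤ n, i+j > n, has support
of cardinality at least 2^i (q-1)^{n-j}. -/
theorem min_support_Uij_high (n q i j : ℕ) (hq : 4 ≤ q) (hij : i ≤ j) (hjn : j ≤ n)
    (hn : n < i + j)
    (f : (Fin n → Fin q) → ℝ) (hf : f ≠ 0) (hmem : memUI n q i j f) :
    2 ^ i * (q - 1) ^ (n - j) ≤ suppCard n q f := by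
  obtain ⟨p, rfl⟩ : ∃ p, q = p + 1 := ⟨q - 1, by omega⟩
  rw [HamSupp.suppCard_eq]
  obtain ⟨k, rfl⟩ : ∃ k, n = j + k := ⟨n - j, by omega⟩
  obtain ⟨e, rfl⟩ : ∃ e, i = k + e := ⟨i - k, by omega⟩
  have := (HamSupp.all_bounds (p := p) (by omega) (j + k)).2.1 j k e rfl f
    (HamSupp.mem_W_of hmem) hf
  refine le_trans (le_of_eq ?_) this
  simp only [Nat.add_sub_cancel, Nat.add_sub_cancel_left]
  rw [mul_pow, pow_add]
  ring
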